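/- Let A ⊆ Λ_s^ℕ be a CAT(Λ_s^ℕ)-invariant subset. If A contains a b,c-eventually periodic sequence, then B_{b,c} ⊆ A, where B_{b,c} is the set of all sequences of the form a₀…a_{b−1}(a_b…a_{b+c−1})^∞. -/

import Mathlib

/-- The left shift on one-sided sequences over the alphabet `A`. -/
def shiftN (A : Type) : (ℕ → A) → (ℕ → A) := fun a k => a (k + 1)

/-- A cellular automaton transformation of the one-sided full shift over `A`:
a continuous map commuting with the left shift. -/
def IsCAT (A : Type) [TopologicalSpace A] (τ : (ℕ → A) → (ℕ → A)) : Prop :=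
  Continuous τ ∧ τ ∘ shiftN A = shiftN A ∘ τ

/-- The semigroup `CAT(Λ^ℕ)` of all cellular automaton transformations. -/
def CATset (A : Type) [TopologicalSpace A] : Set ((ℕ → A) → (ℕ → A)) := {τ | IsCAT A τ}

/-- `a` is a periodic sequence (some positive period). -/
def IsPeriodicSeq {A : Type} (a : ℕ → A) : Prop := ∃ c, 0 < c ∧ ∀ n, a (n + c) = a n

/-- `a` is `c`-periodic: `c` is the minimal positive integer with `a_n = a_{n+c}` for all `n`. -/
def IsPeriodicC {A : Type} (a : ℕ → A) (c : ℕ) : Prop :=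
  (0 < c ∧ ∀ n, a (n + c) = a n) ∧ ∀ c', 0 < c' → (∀ n, a (n + c') = a n) → c ≤ c'

/-- `a` is `b,c`-eventually periodic: `σ^b(a)` is `c`-periodic but `σ^{b-1}(a)` is not
periodic. -/
def IsEvPeriodicBC {A : Type} (a : ℕ → A) (b c : ℕ) : Prop :=
  IsPeriodicC ((shiftN A)^[b] a) c ∧ (0 < b → ¬ IsPeriodicSeq ((shiftN A)^[b - 1] a))

/-- `B_{b,c}`: the set of all sequences of the form `a₀…a_{b−1}(a_b…a_{b+c−1})^∞`,
i.e. sequences satisfying `x_{n+c} = x_n` for all `n ≥ b`. -/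
def Bset (s b c : ℕ) : Set (ℕ → Fin s) := {x | ∀ n, b ≤ n → x (n + c) = x n}

theorem shiftN_iterate_apply {A : Type} (a : ℕ → A) (n k : ℕ) :
    (shiftN A)^[n] a k = a (n + k) := by
  induction n generalizing a with
  | zero => simp
  | succ n ih =>
    rw [Function.iterate_succ_apply, ih, shiftN]
    congr 1
    omega

theorem apply_add_mul_of_period {A : Type} {x : ℕ → A} {b c : ℕ}
    (hx : ∀ n, b ≤ n → x (n + c) = x n) {n : ℕ} (hn : b ≤ n) (j : ℕ) :
    x (n + c * j) = x n := by
  induction j with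
  | zero => simp
  | succ j ih => rw [Nat.mul_succ, ← Nat.add_assoc, hx _ (by omega), ih]

/-- A map that reads off a symbol from each window of length `N` is a cellular automaton
transformation. -/
theorem isCAT_of_local_rule {A : Type} [TopologicalSpace A] [DiscreteTopology A] {N : ℕ}
    (f : (Fin N → A) → A) : IsCAT A fun y n => f fun k => y (n + k) := by
  refine ⟨continuous_pi fun n => ?_, ?_⟩
  · exact (continuous_of_discreteTopology (f := f)).comp
      (continuous_pi fun k => continuous_apply _)
  · funext y n
    simp only [Function.comp_apply, shiftN]
    congr 1
    funext k
    congr 1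
    omega

/-- If coinciding windows of `a` carry the same symbol of `x`, some cellular automaton
transformation maps `a` to `x`. -/
theorem exists_isCAT_apply_eq {A : Type} [TopologicalSpace A] [DiscreteTopology A] {N : ℕ}
    {a x : ℕ → A}
    (h : ∀ n m, (∀ k < N, a (n + k) = a (m + k)) → x n = x m) :
    ∃ τ, IsCAT A τ ∧ τ a = x := by
  classical
  let window : ℕ → Fin N → A := fun n k => a (n + k)
  refine ⟨_, isCAT_of_local_rule (N := N)
    (fun w => if hw : ∃ n, window n = w then x hw.choose else x 0), ?_⟩
  funext n
  have hw : ∃ m, window m = fun k : Fin N => a (n + k) := ⟨n, rfl⟩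
  simp only [dif_pos hw]
  exact h _ _ fun k hk => congrFun hw.choose_spec ⟨k, hk⟩

/-- Two windows of length `b + c` that agree force the whole tails to agree. -/
theorem tails_eq_of_windows_eq {A : Type} {a : ℕ → A} {b c : ℕ} (hc : 0 < c)
    (ha : ∀ n, b ≤ n → a (n + c) = a n) {n m : ℕ}
    (h : ∀ k < b + c, a (n + k) = a (m + k)) (k : ℕ) : a (n + k) = a (m + k) := by
  induction k using Nat.strong_induction_on with
  | _ k ih =>
    by_cases hk : k < b + c
    · exact h k hk
    · obtain ⟨l, rfl⟩ : ∃ l, k = l + c := ⟨k - c, by omega⟩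
      rw [← Nat.add_assoc, ← Nat.add_assoc, ha _ (by omega), ha _ (by omega)]
      exact ih l (by omega)

theorem IsEvPeriodicBC.apply_add {A : Type} {a : ℕ → A} {b c : ℕ}
    (h : IsEvPeriodicBC a b c) (n : ℕ) (hn : b ≤ n) : a (n + c) = a n := by
  obtain ⟨l, rfl⟩ := Nat.exists_eq_add_of_le hn
  simpa only [shiftN_iterate_apply, Nat.add_assoc] using h.1.1.2 l

/-- Distinct equal tails of a `b,c`-eventually periodic sequence start at or after `b`, and
their starting points differ by a multiple of `c`. -/
theorem IsEvPeriodicBC.le_and_dvd_of_tails_eq {A : Type} {a : ℕ → A} {b c : ℕ}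
    (h : IsEvPeriodicBC a b c) {n d : ℕ} (hd : 0 < d)
    (ht : ∀ k, a (n + k) = a (n + d + k)) : b ≤ n ∧ c ∣ d := by
  have hper := h.apply_add
  have hdper : ∀ k, a (b + k + d) = a (b + k) := fun k => by
    by_cases hc : c = 0
    · exact absurd h.1.1.1 (by omega)
    have hle : n ≤ c * n := Nat.le_mul_of_pos_left n (by omega)
    have h1 := apply_add_mul_of_period hper (n := b + k) (by omega) n
    have h2 := apply_add_mul_of_period hper (n := b + k + d) (by omega) n
    rw [← h1, ← h2]
    have h3 := ht (b + k + c * n - n)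
    rw [show n + (b + k + c * n - n) = b + k + c * n by omega,
      show n + d + (b + k + c * n - n) = b + k + d + c * n by omega] at h3
    exact h3.symm
  constructor
  · by_contra hn
    refine h.2 (by omega) ⟨d, hd, fun k => ?_⟩
    rw [shiftN_iterate_apply, shiftN_iterate_apply]
    have h3 := ht (b - 1 - n + k)
    rw [show n + (b - 1 - n + k) = b - 1 + k by omega,
      show n + d + (b - 1 - n + k) = b - 1 + (k + d) by omega] at h3
    exact h3.symm
  · by_contra hcd
    have hpos : 0 < d % c := Nat.pos_of_ne_zero fun h0 => hcd (Nat.dvd_of_mod_eq_zero h0)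
    refine absurd (h.1.2 (d % c) hpos fun k => ?_) (not_le.mpr (Nat.mod_lt d h.1.1.1))
    rw [shiftN_iterate_apply, shiftN_iterate_apply, ← hdper k,
      ← apply_add_mul_of_period hper (n := b + (k + d % c)) (by omega) (d / c)]
    congr 1
    have := Nat.mod_add_div d c
    omega

/-- If `A ⊆ Λ_s^ℕ` is `CAT(Λ_s^ℕ)`-invariant and contains a
`b,c`-eventually periodic sequence, then `B_{b,c} ⊆ A`. -/
theorem Bset_subset_of_invariant (s b c : ℕ) (hs : 2 ≤ s) (A : Set (ℕ → Fin s))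
    (hinv : ∀ τ ∈ CATset (Fin s), ∀ x ∈ A, τ x ∈ A)
    (a : ℕ → Fin s) (ha : a ∈ A) (hbc : IsEvPeriodicBC a b c) :
    Bset s b c ⊆ A := by
  intro x hx
  have key : ∀ n d, (∀ k, a (n + k) = a (n + d + k)) → x n = x (n + d) := by
    intro n d ht
    rcases Nat.eq_zero_or_pos d with rfl | hd
    · rfl
    · obtain ⟨hn, j, rfl⟩ := hbc.le_and_dvd_of_tails_eq hd ht
      exact (apply_add_mul_of_period hx hn j).symm
  obtain ⟨τ, hτ, rfl⟩ : ∃ τ, IsCAT (Fin s) τ ∧ τ a = x := by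
    refine exists_isCAT_apply_eq (N := b + c) fun n m hw => ?_
    have ht := tails_eq_of_windows_eq hbc.1.1.1 hbc.apply_add hw
    rcases le_total n m with hnm | hnm <;> obtain ⟨d, rfl⟩ := Nat.exists_eq_add_of_le hnm
    · exact key n d ht
    · exact (key m d fun k => (ht k).symm).symm
  exact hinv τ hτ a ha
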